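/- For any t₀ ≥ 0, x₀ ∈ Ω and any measurable control u : [t₀,∞) → B̄(0,1), one has φ(t₀,x₀) ≤ (t − t₀) + φ(t, γ^{t₀,x₀,u}(t)) for all t ∈ [t₀, t₀ + τ^{t₀,x₀,u}]; moreover, if u is optimal for x₀ at time t₀, then φ(t₀,x₀) = (t − t₀) + φ(t, γ^{t₀,x₀,u}(t)) for all such t. -/

import Mathlib

open MeasureTheory Filter Set Metric
open scoped Topology RealInnerProductSpace NNReal ENNReal

noncomputable section

abbrev Evec (d : ℕ) := EuclideanSpace ℝ (Fin d)

variable {d : ℕ}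

/-- An admissible control: a measurable function with values in the closed unit ball. -/
def IsControl (u : ℝ → Evec d) : Prop :=
  Measurable u ∧ ∀ t, ‖u t‖ ≤ 1

/-- `γ` is the (absolutely continuous) trajectory of the control system
`γ'(t) = k(t, γ(t)) u(t)` for a.e. `t ≥ t₀`, `γ(t₀) = x₀`, written in integral form. -/
def IsTrajectory (k : ℝ → Evec d → ℝ) (t₀ : ℝ) (x₀ : Evec d) (u γ : ℝ → Evec d) : Prop :=
  ∀ t, t₀ ≤ t → γ t = x₀ + ∫ s in t₀..t, k s (γ s) • u s

/-- The set of nonnegative elapsed times at which a trajectory started at time `t₀`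
lies on the boundary of `Ω`. -/
def exitSet (Ω : Set (Evec d)) (t₀ : ℝ) (γ : ℝ → Evec d) : Set ℝ :=
  {τ : ℝ | 0 ≤ τ ∧ γ (t₀ + τ) ∈ frontier Ω}

/-- The exit time `τ^{t₀,x₀,u}` (with junk value `sInf ∅ = 0` if the trajectory never
reaches the boundary). -/
def exitTime (Ω : Set (Evec d)) (t₀ : ℝ) (γ : ℝ → Evec d) : ℝ :=
  sInf (exitSet Ω t₀ γ)

/-- The cost `τ^{t₀,x₀,u} + g(γ^{t₀,x₀,u}_τ)`. -/
def exitCost (Ω : Set (Evec d)) (g : Evec d → ℝ) (t₀ : ℝ) (γ : ℝ → Evec d) : ℝ :=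
  exitTime Ω t₀ γ + g (γ (t₀ + exitTime Ω t₀ γ))

/-- The set of costs achievable from `(t₀, x₀)` by admissible controls whose
trajectory reaches the boundary. -/
def costSet (Ω : Set (Evec d)) (k : ℝ → Evec d → ℝ) (g : Evec d → ℝ)
    (t₀ : ℝ) (x₀ : Evec d) : Set ℝ :=
  {r | ∃ u γ, IsControl u ∧ IsTrajectory k t₀ x₀ u γ ∧ (exitSet Ω t₀ γ).Nonempty ∧
    r = exitCost Ω g t₀ γ}

/-- The value function `φ(t, x)`. -/
def valueFun (Ω : Set (Evec d)) (k : ℝ → Evec d → ℝ) (g : Evec d → ℝ)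
    (t : ℝ) (x : Evec d) : ℝ :=
  sInf (costSet Ω k g t x)

/-- `u` (with associated trajectory `γ`) is an optimal control for `x₀` at time `t₀`. -/
def IsOptimal (Ω : Set (Evec d)) (k : ℝ → Evec d → ℝ) (g : Evec d → ℝ)
    (t₀ : ℝ) (x₀ : Evec d) (u γ : ℝ → Evec d) : Prop :=
  IsControl u ∧ IsTrajectory k t₀ x₀ u γ ∧ (exitSet Ω t₀ γ).Nonempty ∧
  IsLeast (costSet Ω k g t₀ x₀) (exitCost Ω g t₀ γ)

section Trajectories

variable {Ω : Set (Evec d)} {k : ℝ → Evec d → ℝ} {g : Evec d → ℝ} {kmin kmax t₀ t : ℝ}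
  {x₀ : Evec d} {u γ u' γ' : ℝ → Evec d}

lemma continuous_clamp_time
    (hk : ContinuousOn (fun p : ℝ × Evec d => k p.1 p.2) (Set.Ici 0 ×ˢ Set.univ)) :
    Continuous fun p : ℝ × Evec d => k (max p.1 0) p.2 :=
  hk.comp_continuous (f := fun p : ℝ × Evec d => (max p.1 0, p.2)) (by fun_prop)
    fun p => ⟨mem_Ici.2 (le_max_right _ _), mem_univ _⟩

lemma norm_velocity_le (hb : ∀ t x, 0 ≤ t → 0 ≤ k t x ∧ k t x ≤ kmax) (hu : IsControl u)
    {s : ℝ} (hs : 0 ≤ s) (x : Evec d) : ‖k s x • u s‖ ≤ kmax := by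
  obtain ⟨h0, h1⟩ := hb s x hs
  rw [norm_smul, Real.norm_of_nonneg h0]
  nlinarith [hu.2 s, norm_nonneg (u s)]

lemma IsTrajectory.norm_sub_le (hγ : IsTrajectory k t₀ x₀ u γ) (ht₀ : 0 ≤ t₀)
    (hb : ∀ t x, 0 ≤ t → 0 ≤ k t x ∧ k t x ≤ kmax) (hu : IsControl u)
    {a b : ℝ} (ha : t₀ ≤ a) (hb' : t₀ ≤ b)
    (hia : IntervalIntegrable (fun s => k s (γ s) • u s) volume t₀ a)
    (hib : IntervalIntegrable (fun s => k s (γ s) • u s) volume t₀ b) :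
    ‖γ b - γ a‖ ≤ kmax * |b - a| := by
  rw [hγ a ha, hγ b hb', add_sub_add_left_eq_sub,
    intervalIntegral.integral_interval_sub_left hib hia]
  refine intervalIntegral.norm_integral_le_of_norm_le_const fun s hs => ?_
  exact norm_velocity_le hb hu (ht₀.trans ((le_min ha hb').trans hs.1.le)) _

lemma IsTrajectory.intervalIntegrable (hγ : IsTrajectory k t₀ x₀ u γ) (ht₀ : 0 ≤ t₀)
    (hk : ContinuousOn (fun p : ℝ × Evec d => k p.1 p.2) (Set.Ici 0 ×ˢ Set.univ))
    (hb : ∀ t x, 0 ≤ t → 0 ≤ k t x ∧ k t x ≤ kmax) (hu : IsControl u)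
    {a b : ℝ} (ha : t₀ ≤ a) (hab : a ≤ b) :
    IntervalIntegrable (fun s => k s (γ s) • u s) volume a b := by
  have hmax : 0 ≤ kmax := (hb t₀ x₀ ht₀).1.trans (hb t₀ x₀ ht₀).2
  set S : Set ℝ := {t | t₀ ≤ t ∧ IntervalIntegrable (fun s => k s (γ s) • u s) volume t₀ t}
    with hS
  have hSord : S.OrdConnected := by
    refine ⟨fun x hx y hy z hz => ⟨hx.1.trans hz.1, hy.2.mono_set ?_⟩⟩
    rw [uIcc_of_le (hx.1.trans hz.1), uIcc_of_le hy.1]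
    exact Icc_subset_Icc_right hz.2
  have hSm : MeasurableSet S := hSord.measurableSet
  have hcont : ContinuousOn γ S := by
    refine LipschitzOnWith.continuousOn (K := kmax.toNNReal) ?_
    refine LipschitzOnWith.of_dist_le_mul fun x hx y hy => ?_
    rw [dist_eq_norm, Real.dist_eq, Real.coe_toNNReal _ hmax]
    exact hγ.norm_sub_le ht₀ hb hu hy.1 hx.1 hy.2 hx.2
  have hγm : AEStronglyMeasurable γ (volume.restrict (Ici t₀)) := by
    have h1 : AEStronglyMeasurable γ (volume.restrict S) := hcont.aestronglyMeasurable hSm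
    have h2 : AEStronglyMeasurable γ (volume.restrict (Ici t₀ \ S)) := by
      refine (aestronglyMeasurable_const (b := x₀)).congr ?_
      refine (ae_restrict_iff' (measurableSet_Ici.diff hSm)).2 (ae_of_all _ fun s hs => ?_)
      rw [hγ s hs.1, intervalIntegral.integral_undef fun h => hs.2 ⟨hs.1, h⟩, add_zero]
    have h3 : S ∪ (Ici t₀ \ S) = Ici t₀ := union_sdiff_cancel fun s hs => hs.1
    rw [← h3, aestronglyMeasurable_union_iff]
    exact ⟨h1, h2⟩
  have hfm : AEStronglyMeasurable (fun s => k s (γ s) • u s) (volume.restrict (Ici t₀)) := by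
    have h1 : AEStronglyMeasurable (fun s => k (max s 0) (γ s) • u s)
        (volume.restrict (Ici t₀)) :=
      ((continuous_clamp_time hk).comp_aestronglyMeasurable
        (aestronglyMeasurable_id.prodMk hγm)).smul hu.1.aestronglyMeasurable
    refine h1.congr ((ae_restrict_iff' measurableSet_Ici).2 (ae_of_all _ fun s hs => ?_))
    simp only [max_eq_left (ht₀.trans hs)]
  rw [intervalIntegrable_iff_integrableOn_Ioc_of_le hab]
  have hsub : Ioc a b ⊆ Ici t₀ := fun s hs => ha.trans hs.1.le
  exact Integrable.of_bound (hfm.mono_set hsub) kmax <| (ae_restrict_iff' measurableSet_Ioc).2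
    (ae_of_all _ fun s hs => norm_velocity_le hb hu (ht₀.trans (hsub hs)) _)

lemma IsTrajectory.continuousOn (hγ : IsTrajectory k t₀ x₀ u γ) (ht₀ : 0 ≤ t₀)
    (hk : ContinuousOn (fun p : ℝ × Evec d => k p.1 p.2) (Set.Ici 0 ×ˢ Set.univ))
    (hb : ∀ t x, 0 ≤ t → 0 ≤ k t x ∧ k t x ≤ kmax) (hu : IsControl u) :
    ContinuousOn γ (Ici t₀) := by
  have hmax : 0 ≤ kmax := (hb t₀ x₀ ht₀).1.trans (hb t₀ x₀ ht₀).2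
  refine LipschitzOnWith.continuousOn (K := kmax.toNNReal) ?_
  refine LipschitzOnWith.of_dist_le_mul fun x hx y hy => ?_
  rw [dist_eq_norm, Real.dist_eq, Real.coe_toNNReal _ hmax]
  exact hγ.norm_sub_le ht₀ hb hu hy hx (hγ.intervalIntegrable ht₀ hk hb hu le_rfl hy)
    (hγ.intervalIntegrable ht₀ hk hb hu le_rfl hx)

lemma IsTrajectory.apply_start (hγ : IsTrajectory k t₀ x₀ u γ) : γ t₀ = x₀ := by
  simpa using hγ t₀ le_rfl

/-- The tail of a trajectory is a trajectory. -/
lemma IsTrajectory.tail (hγ : IsTrajectory k t₀ x₀ u γ) (ht₀ : 0 ≤ t₀)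
    (hk : ContinuousOn (fun p : ℝ × Evec d => k p.1 p.2) (Set.Ici 0 ×ˢ Set.univ))
    (hb : ∀ t x, 0 ≤ t → 0 ≤ k t x ∧ k t x ≤ kmax) (hu : IsControl u) (ht : t₀ ≤ t) :
    IsTrajectory k t (γ t) u γ := by
  intro r hr
  rw [hγ r (ht.trans hr), hγ t ht, add_assoc,
    intervalIntegral.integral_add_adjacent_intervals
      (hγ.intervalIntegrable ht₀ hk hb hu le_rfl ht)
      (hγ.intervalIntegrable ht₀ hk hb hu ht hr)]

lemma integral_congr_of_eqOn_uIoc {f f' : ℝ → Evec d} {a b : ℝ} (h : EqOn f f' (uIoc a b)) :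
    ∫ s in a..b, f s = ∫ s in a..b, f' s :=
  intervalIntegral.integral_congr_ae (ae_of_all _ h)

/-- The concatenation of two curves at time `t`. -/
def concatAt (t : ℝ) (f f' : ℝ → Evec d) (s : ℝ) : Evec d := if s ≤ t then f s else f' s

lemma IsControl.concatAt (hu : IsControl u) (hu' : IsControl u') :
    IsControl (concatAt t u u') := by
  refine ⟨Measurable.ite measurableSet_Iic hu.1 hu'.1, fun s => ?_⟩
  unfold _root_.concatAt
  split_ifs
  exacts [hu.2 s, hu'.2 s]

lemma concatAt_of_ge (h : γ' t = γ t) {s : ℝ} (hs : t ≤ s) : concatAt t γ γ' s = γ' s := by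
  unfold concatAt
  split_ifs with h'
  · rw [le_antisymm h' hs, h]
  · rfl

lemma IsTrajectory.concatAt (hγ : IsTrajectory k t₀ x₀ u γ) (ht₀ : 0 ≤ t₀)
    (hk : ContinuousOn (fun p : ℝ × Evec d => k p.1 p.2) (Set.Ici 0 ×ˢ Set.univ))
    (hb : ∀ t x, 0 ≤ t → 0 ≤ k t x ∧ k t x ≤ kmax) (hu : IsControl u) (ht : t₀ ≤ t)
    (hu' : IsControl u') (hγ' : IsTrajectory k t (γ t) u' γ') :
    IsTrajectory k t₀ x₀ (concatAt t u u') (concatAt t γ γ') := by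
  have hbefore : ∀ r, t₀ ≤ r → r ≤ t → EqOn (fun s => k s (γ s) • u s)
      (fun s => k s (_root_.concatAt t γ γ' s) • _root_.concatAt t u u' s) (uIoc t₀ r) := by
    intro r hr hrt s hs
    rw [uIoc_of_le hr] at hs
    simp only [_root_.concatAt, if_pos (hs.2.trans hrt)]
  have hafter : ∀ r, t ≤ r → EqOn (fun s => k s (γ' s) • u' s)
      (fun s => k s (_root_.concatAt t γ γ' s) • _root_.concatAt t u u' s) (uIoc t r) := by
    intro r hr s hs
    rw [uIoc_of_le hr] at hs
    simp only [_root_.concatAt, if_neg hs.1.not_ge]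
  intro r hr
  rcases le_or_gt r t with hrt | hrt
  · rw [← integral_congr_of_eqOn_uIoc (hbefore r hr hrt), ← hγ r hr]
    exact if_pos hrt
  · rw [← intervalIntegral.integral_add_adjacent_intervals
        ((hγ.intervalIntegrable ht₀ hk hb hu le_rfl ht).congr (hbefore t ht le_rfl))
        ((hγ'.intervalIntegrable (ht₀.trans ht) hk hb hu' le_rfl hrt.le).congr
          (hafter r hrt.le)),
      ← integral_congr_of_eqOn_uIoc (hbefore t ht le_rfl),
      ← integral_congr_of_eqOn_uIoc (hafter r hrt.le), ← add_assoc, ← hγ t ht,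
      ← hγ' r hrt.le]
    exact if_neg hrt.not_ge

lemma exitSet_bddBelow : BddBelow (exitSet Ω t₀ γ) := ⟨0, fun _ h => h.1⟩

lemma exitTime_nonneg : 0 ≤ exitTime Ω t₀ γ := Real.sInf_nonneg fun _ h => h.1

lemma exitTime_mem_exitSet (hγ : ContinuousOn γ (Ici t₀)) (hne : (exitSet Ω t₀ γ).Nonempty) :
    exitTime Ω t₀ γ ∈ exitSet Ω t₀ γ := by
  refine IsClosed.csInf_mem ?_ hne exitSet_bddBelow
  have h : ContinuousOn (fun τ => γ (t₀ + τ)) (Ici 0) :=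
    hγ.comp (by fun_prop) fun τ hτ => by simpa using hτ
  exact h.preimage_isClosed_of_isClosed isClosed_Ici isClosed_frontier

lemma exitCost_nonneg (hg : ∀ x ∈ frontier Ω, 0 ≤ g x) (hγ : ContinuousOn γ (Ici t₀))
    (hne : (exitSet Ω t₀ γ).Nonempty) : 0 ≤ exitCost Ω g t₀ γ :=
  add_nonneg exitTime_nonneg (hg _ (exitTime_mem_exitSet hγ hne).2)

lemma costSet_bddBelow (ht₀ : 0 ≤ t₀)
    (hk : ContinuousOn (fun p : ℝ × Evec d => k p.1 p.2) (Set.Ici 0 ×ˢ Set.univ))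
    (hb : ∀ t x, 0 ≤ t → 0 ≤ k t x ∧ k t x ≤ kmax) (hg : ∀ x ∈ frontier Ω, 0 ≤ g x) :
    BddBelow (costSet Ω k g t₀ x₀) := by
  refine ⟨0, ?_⟩
  rintro _ ⟨u, γ, hu, hγ, hne, rfl⟩
  exact exitCost_nonneg hg (hγ.continuousOn ht₀ hk hb hu) hne

/-- Every boundary point can be reached from every point, by moving along the segment
joining them at the speed `kmin`. -/
lemma costSet_nonempty (ht₀ : 0 ≤ t₀)
    (hk : ContinuousOn (fun p : ℝ × Evec d => k p.1 p.2) (Set.Ici 0 ×ˢ Set.univ))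
    (hkmin : 0 < kmin) (hb : ∀ t x, 0 ≤ t → kmin ≤ k t x)
    (hne : (frontier Ω).Nonempty) : (costSet Ω k g t₀ x₀).Nonempty := by
  obtain ⟨y, hy⟩ := hne
  set e : Evec d := ‖y - x₀‖⁻¹ • (y - x₀) with he
  have he1 : ‖e‖ ≤ 1 := by
    rw [he, norm_smul, norm_inv, norm_norm]
    exact inv_mul_le_one
  have hey : ‖y - x₀‖ • e = y - x₀ := by
    rcases eq_or_ne (y - x₀) 0 with h | h
    · simp [h]
    · exact smul_inv_smul₀ (norm_ne_zero_iff.2 h) _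
  set γ : ℝ → Evec d := fun s => x₀ + ((s - t₀) * kmin) • e with hγ
  set u : ℝ → Evec d := fun s => (kmin / k (max s 0) (γ s)) • e with hu
  have hγc : Continuous γ := by fun_prop
  have hpos : ∀ s, 0 < k (max s 0) (γ s) := fun s => hkmin.trans_le (hb _ _ (le_max_right _ _))
  have huc : Continuous u := by
    refine (continuous_const.div ?_ fun s => (hpos s).ne').smul continuous_const
    exact (continuous_clamp_time hk).comp (continuous_id.prodMk hγc)
  refine ⟨_, u, γ, ⟨huc.measurable, fun s => ?_⟩, fun r hr => ?_,
    ⟨‖y - x₀‖ / kmin, by positivity, ?_⟩, rfl⟩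
  · rw [hu, norm_smul, Real.norm_of_nonneg (div_nonneg hkmin.le (hpos s).le)]
    exact mul_le_one₀ ((div_le_one (hpos s)).2 (hb _ _ (le_max_right _ _)))
      (norm_nonneg _) he1
  · have h : EqOn (fun s => k s (γ s) • u s) (fun _ => kmin • e) (uIoc t₀ r) := by
      intro s hs
      rw [uIoc_of_le hr] at hs
      have h' := (hpos s).ne'
      simp only [hu, smul_smul]
      rw [max_eq_left (ht₀.trans hs.1.le)] at h' ⊢
      rw [mul_div_cancel₀ _ h']
    rw [integral_congr_of_eqOn_uIoc h, intervalIntegral.integral_const, smul_smul]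
  · have : γ (t₀ + ‖y - x₀‖ / kmin) = y := by
      simp only [hγ, add_sub_cancel_left, div_mul_cancel₀ _ hkmin.ne', hey, add_sub_cancel]
    rwa [this]

/-- Before the exit, the remaining exit cost of a trajectory decreases at unit speed. -/
lemma exitCost_eq_add (ht : t₀ ≤ t) (hE : ∀ τ ∈ exitSet Ω t₀ γ, t ≤ t₀ + τ)
    (hγ' : ∀ s, t ≤ s → γ s = γ' s) (hne : (exitSet Ω t γ').Nonempty) :
    (exitSet Ω t₀ γ).Nonempty ∧ exitCost Ω g t₀ γ = (t - t₀) + exitCost Ω g t γ' := by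
  have hmem : ∀ τ ∈ exitSet Ω t γ', (t - t₀) + τ ∈ exitSet Ω t₀ γ := fun τ hτ => by
    refine ⟨add_nonneg (sub_nonneg.2 ht) hτ.1, ?_⟩
    rw [← add_assoc, add_sub_cancel, hγ' _ (le_add_of_nonneg_right hτ.1)]
    exact hτ.2
  have hmem' : ∀ τ ∈ exitSet Ω t₀ γ, τ - (t - t₀) ∈ exitSet Ω t γ' := fun τ hτ => by
    have h := hE τ hτ
    refine ⟨by linarith, ?_⟩
    rw [show t + (τ - (t - t₀)) = t₀ + τ by ring, ← hγ' _ h]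
    exact hτ.2
  have hne' : (exitSet Ω t₀ γ).Nonempty := hne.imp' _ hmem
  have htime : exitTime Ω t₀ γ = (t - t₀) + exitTime Ω t γ' := by
    refine le_antisymm ?_ (le_csInf hne' fun τ hτ => ?_)
    · rw [← sub_le_iff_le_add']
      exact le_csInf hne fun τ hτ =>
        sub_le_iff_le_add'.2 (csInf_le exitSet_bddBelow (hmem τ hτ))
    · exact le_sub_iff_add_le'.1 (csInf_le exitSet_bddBelow (hmem' τ hτ))
  refine ⟨hne', ?_⟩
  simp only [exitCost]
  rw [htime, ← add_assoc t₀, add_sub_cancel, hγ' _ (le_add_of_nonneg_right exitTime_nonneg),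
    add_assoc]

lemma valueFun_le_add (ht₀ : 0 ≤ t₀)
    (hk : ContinuousOn (fun p : ℝ × Evec d => k p.1 p.2) (Set.Ici 0 ×ˢ Set.univ))
    (hkmin : 0 < kmin) (hb : ∀ t x, 0 ≤ t → kmin ≤ k t x ∧ k t x ≤ kmax)
    (hg : ∀ x ∈ frontier Ω, 0 ≤ g x) (hu : IsControl u) (hγ : IsTrajectory k t₀ x₀ u γ)
    (ht : t₀ ≤ t) (hE : ∀ τ ∈ exitSet Ω t₀ γ, t ≤ t₀ + τ) :
    valueFun Ω k g t₀ x₀ ≤ (t - t₀) + valueFun Ω k g t (γ t) := by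
  have hb' : ∀ t x, 0 ≤ t → 0 ≤ k t x ∧ k t x ≤ kmax := fun t x h =>
    ⟨hkmin.le.trans (hb t x h).1, (hb t x h).2⟩
  rcases (frontier Ω).eq_empty_or_nonempty with hΩ | hΩ
  · have h : ∀ s x, valueFun Ω k g s x = 0 := fun s x => by
      simp [valueFun, costSet, exitSet, hΩ]
    simpa [h] using ht
  rw [← sub_le_iff_le_add']
  refine le_csInf (costSet_nonempty (ht₀.trans ht) hk hkmin (fun t x h => (hb t x h).1) hΩ) ?_
  rintro _ ⟨u', γ', hu', hγ', hne, rfl⟩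
  have hE' : ∀ τ ∈ exitSet Ω t₀ (concatAt t γ γ'), t ≤ t₀ + τ := by
    intro τ hτ
    by_contra! hlt
    have h := hτ.2
    rw [concatAt, if_pos hlt.le] at h
    exact hlt.not_ge (hE τ ⟨hτ.1, h⟩)
  obtain ⟨hne', hcost⟩ := exitCost_eq_add (g := g) ht hE'
    (fun s hs => concatAt_of_ge hγ'.apply_start hs) hne
  rw [sub_le_iff_le_add', ← hcost]
  exact csInf_le (costSet_bddBelow ht₀ hk hb' hg)
    ⟨_, _, hu.concatAt hu', hγ.concatAt ht₀ hk hb' hu ht hu' hγ', hne', rfl⟩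

end Trajectories

/-- The dynamic programming principle for the value function. -/
theorem dynamic_programming_principle
    (Ω : Set (Evec d)) (hΩcomp : IsCompact Ω) (hΩreg : Ω = closure (interior Ω))
    (hΩne : (interior Ω).Nonempty)
    (k : ℝ → Evec d → ℝ) (kmin kmax L₁ : ℝ)
    (hkcont : ContinuousOn (fun p : ℝ × Evec d => k p.1 p.2) (Set.Ici 0 ×ˢ Set.univ))
    (hkmin : 0 < kmin)
    (hkbdd : ∀ t x, 0 ≤ t → kmin ≤ k t x ∧ k t x ≤ kmax)
    (hklip : ∀ t, 0 ≤ t → ∀ x₁ x₂ : Evec d, |k t x₁ - k t x₂| ≤ L₁ * ‖x₁ - x₂‖)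
    (g : Evec d → ℝ) (hgcont : ContinuousOn g (frontier Ω))
    (hg0 : ∀ x ∈ frontier Ω, 0 ≤ g x)
    (lam : ℝ) (hlam : 0 < lam) (hlamk : lam < 1 / kmax)
    (hglip : ∀ x ∈ frontier Ω, ∀ y ∈ frontier Ω, |g x - g y| ≤ lam * ‖x - y‖)
    (t₀ : ℝ) (ht₀ : 0 ≤ t₀) (x₀ : Evec d) (hx₀ : x₀ ∈ Ω) :
    (∀ u γ : ℝ → Evec d, IsControl u → IsTrajectory k t₀ x₀ u γ →
      ∀ t, t₀ ≤ t → (∀ τ ∈ exitSet Ω t₀ γ, t ≤ t₀ + τ) →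
        valueFun Ω k g t₀ x₀ ≤ (t - t₀) + valueFun Ω k g t (γ t)) ∧
    (∀ u γ : ℝ → Evec d, IsOptimal Ω k g t₀ x₀ u γ →
      ∀ t, t₀ ≤ t → t ≤ t₀ + exitTime Ω t₀ γ →
        valueFun Ω k g t₀ x₀ = (t - t₀) + valueFun Ω k g t (γ t)) := by
  have hb : ∀ t x, 0 ≤ t → 0 ≤ k t x ∧ k t x ≤ kmax := fun t x h =>
    ⟨hkmin.le.trans (hkbdd t x h).1, (hkbdd t x h).2⟩
  refine ⟨fun u γ hu hγ t ht hE => valueFun_le_add ht₀ hkcont hkmin hkbdd hg0 hu hγ ht hE,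
    fun u γ ⟨hu, hγ, hne, hopt⟩ t ht htE => ?_⟩
  have hE : ∀ τ ∈ exitSet Ω t₀ γ, t ≤ t₀ + τ := fun τ hτ =>
    htE.trans (add_le_add_right (csInf_le exitSet_bddBelow hτ) _)
  refine le_antisymm (valueFun_le_add ht₀ hkcont hkmin hkbdd hg0 hu hγ ht hE) ?_
  have hne' : (exitSet Ω t γ).Nonempty := by
    obtain ⟨τ, hτ⟩ := hne
    refine ⟨t₀ + τ - t, sub_nonneg.2 (hE τ hτ), ?_⟩
    rw [add_sub_cancel]
    exact hτ.2
  rw [show valueFun Ω k g t₀ x₀ = _ from hopt.csInf_eq, (exitCost_eq_add ht hE (fun _ _ => rfl) hne').2]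
  exact add_le_add_right (csInf_le (costSet_bddBelow (ht₀.trans ht) hkcont hb hg0)
    ⟨u, γ, hu, hγ.tail ht₀ hkcont hb hu ht, hne', rfl⟩) _
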